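/- arXiv:2204.11770 — 2 statements merged into one kernel-verified Lean document; each statement's English description precedes it below -/
import Mathlib

section
/- Let A be the companion matrix of f(x) = (x-1)^5 and B the companion matrix of g(x) = (x+1)^5, and set T = B·A⁻¹ in GL(5,ℚ). Then T² = I with T ≠ I, B has infinite order, and the hypergeometric group Γ(f,g) = ⟨A,B⟩ is the free product of the subgroup generated by T and the subgroup generated by B: the canonical group homomorphism from the abstract free product (ℤ/2ℤ) ∗ ℤ to GL(5,ℚ) sending the generator of ℤ/2ℤ to T and the generator of ℤ to B is injective with image Γ(f,g). -/
open Polynomial Matrix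

/-- The companion matrix of a monic degree-5 rational polynomial `p`:
the `5 × 5` matrix whose entries in position `(i+1, i)` equal `1` for
`i = 1, ..., 4`, whose last column is `(-p₀, -p₁, -p₂, -p₃, -p₄)ᵀ`
(where `pᵢ` is the coefficient of `xⁱ` in `p`), and whose remaining
entries are `0`. -/
def companionMatrix (p : ℚ[X]) : Matrix (Fin 5) (Fin 5) ℚ :=
  Matrix.of fun i j : Fin 5 =>
    if (j : ℕ) = 4 then -p.coeff i
    else if (i : ℕ) = (j : ℕ) + 1 then 1 else 0

section PingPong

/-- The two-member family with members `G` and `H`. -/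
def pairFamily (G H : Type) (i : Bool) : Type :=
  cond i H G

instance pairFamilyGroup (G H : Type) [Group G] [Group H] : ∀ i, Group (pairFamily G H i)
  | false => inferInstanceAs (Group G)
  | true => inferInstanceAs (Group H)

/-- The ping-pong lemma for a free product of two groups. -/
theorem coprod_lift_injective_of_ping_pong {G H K α : Type} [Group G] [Group H] [Group K]
    [MulAction K α] [Infinite H] (f : G →* K) (g : H →* K) (X Y : Set α)
    (hX : X.Nonempty) (hY : Y.Nonempty) (hXY : Disjoint X Y)
    (hf : ∀ a : G, a ≠ 1 → ∀ y ∈ Y, f a • y ∈ X)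
    (hg : ∀ b : H, b ≠ 1 → ∀ x ∈ X, g b • x ∈ Y) :
    Function.Injective (Monoid.Coprod.lift f g) := by
  let m : ∀ i, pairFamily G H i →* K := Bool.rec f g
  let Z : Bool → Set α := fun i => Bool.rec X Y i
  have hinj : Function.Injective (Monoid.CoprodI.lift m) := by
    refine Monoid.CoprodI.lift_injective_of_ping_pong m (Or.inr ⟨true, ?_⟩) Z ?_ ?_ ?_
    · exact (Cardinal.natCast_lt_aleph0 (n := 3)).le.trans (Cardinal.aleph0_le_mk H)
    · rintro (_ | _)
      exacts [hX, hY]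
    · rintro (_ | _) (_ | _) h
      exacts [(h rfl).elim, hXY, hXY.symm, (h rfl).elim]
    · rintro (_ | _) (_ | _) h a ha
      · exact (h rfl).elim
      · rintro _ ⟨y, hy, rfl⟩
        exact hf a ha y hy
      · rintro _ ⟨x, hx, rfl⟩
        exact hg a ha x hx
      · exact (h rfl).elim
  let j : Monoid.Coprod G H →* Monoid.CoprodI (pairFamily G H) :=
    Monoid.Coprod.lift (Monoid.CoprodI.of (M := pairFamily G H) (i := false))
      (Monoid.CoprodI.of (M := pairFamily G H) (i := true))
  let r : Monoid.CoprodI (pairFamily G H) →* Monoid.Coprod G H :=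
    Monoid.CoprodI.lift fun i => Bool.rec (motive := fun i => pairFamily G H i →* Monoid.Coprod G H)
      Monoid.Coprod.inl Monoid.Coprod.inr i
  have hrj : r.comp j = MonoidHom.id _ := by
    ext a
    · exact Monoid.CoprodI.lift_of _ _
    · exact Monoid.CoprodI.lift_of _ _
  have hmj : (Monoid.CoprodI.lift m).comp j = Monoid.Coprod.lift f g := by
    ext a
    · exact Monoid.CoprodI.lift_of _ _
    · exact Monoid.CoprodI.lift_of _ _
  rw [← hmj]
  exact hinj.comp (Function.LeftInverse.injective (g := r) fun x => DFunLike.congr_fun hrj x)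

/-- A ping-pong criterion in the presence of an involution `s` that commutes with the involution
`t` and inverts `b`: it suffices to control the half `C` of one of the two ping-pong sets. -/
theorem coprod_lift_injective_of_reflection {K α : Type} [Group K] [MulAction K α] {t b s : K}
    (ht : t ^ 2 = 1) (hs : s * s = 1) (hst : s * t = t * s) (hsb : s * b * s = b⁻¹) {C : Set α}
    (hC : C.Nonempty) (hb : ∀ x ∈ C, b • x ∈ C) (hbt : ∀ x ∈ C, (b * t) • x ∈ C)
    (hbts : ∀ x ∈ C, (b * t * s) • x ∈ C)
    (hdisj : ∀ x, x ∈ C ∨ s • x ∈ C → ¬ (t • x ∈ C ∨ s • t • x ∈ C))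
    (f : Multiplicative (ZMod 2) →* K) (hf : f (Multiplicative.ofAdd 1) = t)
    (g : Multiplicative ℤ →* K) (hg : g (Multiplicative.ofAdd 1) = b) :
    Function.Injective (Monoid.Coprod.lift f g) := by
  have htt : t * t = 1 := by rw [← sq, ht]
  have hpos : ∀ n : ℕ, ∀ x, t • x ∈ C ∨ s • t • x ∈ C → b ^ (n + 1) • x ∈ C := by
    intro n x hx
    induction n with
    | zero =>
      rw [zero_add, pow_one]
      rcases hx with hx | hx
      · simpa [smul_smul, mul_assoc, htt] using hbt _ hx
      · have h : b * t * s * (s * t) = b := by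
          rw [mul_assoc, ← mul_assoc s, hs, one_mul, mul_assoc, htt, mul_one]
        simpa [smul_smul, h] using hbts _ hx
    | succ n ih =>
      rw [pow_succ', mul_smul]
      exact hb _ ih
  have hgz : ∀ k : ℤ, g (Multiplicative.ofAdd k) = b ^ k := fun k => by
    rw [← hg, ← map_zpow, ← ofAdd_zsmul, smul_eq_mul, mul_one]
  obtain ⟨c, hc⟩ := hC
  refine coprod_lift_injective_of_ping_pong f g {x | t • x ∈ C ∨ s • t • x ∈ C}
    {x | x ∈ C ∨ s • x ∈ C} ⟨t • c, Or.inl ?_⟩ ⟨c, Or.inl hc⟩ ?_ ?_ ?_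
  · rwa [smul_smul, htt, one_smul]
  · exact Set.disjoint_right.2 hdisj
  · intro a ha y hy
    have h : a = Multiplicative.ofAdd 1 := by
      revert ha
      revert a
      decide
    rw [h, hf]
    simpa [smul_smul, htt, mul_assoc] using hy
  · intro k hk x hx
    obtain ⟨k, rfl⟩ := Multiplicative.ofAdd.surjective k
    rw [hgz]
    rcases lt_trichotomy k 0 with h | rfl | h
    · obtain ⟨n, rfl⟩ : ∃ n : ℕ, k = -((n + 1 : ℕ) : ℤ) := ⟨k.natAbs - 1, by omega⟩
      have hss : s⁻¹ = s := inv_eq_of_mul_eq_one_right hs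
      have hpow : s * b ^ (-((n + 1 : ℕ) : ℤ)) = b ^ (n + 1) * s := by
        have h : (s * b * s⁻¹) ^ (n + 1) = s * b ^ (n + 1) * s⁻¹ := conj_pow
        rw [hss, hsb, inv_pow] at h
        rw [_root_.zpow_neg, zpow_natCast, h, ← mul_assoc, ← mul_assoc, hs, one_mul]
      right
      rw [smul_smul, hpow, mul_smul]
      refine hpos n _ ?_
      rw [smul_smul, ← hst, smul_smul, ← mul_assoc, hs, one_mul, mul_smul]
      exact hx.symm
    · exact (hk rfl).elim
    · obtain ⟨n, rfl⟩ : ∃ n : ℕ, k = ((n + 1 : ℕ) : ℤ) := ⟨k.natAbs - 1, by omega⟩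
      left
      rw [zpow_natCast]
      exact hpos n x hx

end PingPong

theorem exists_monoidHom_of_sq_eq_one {K : Type} [Group K] {t : K} (ht : t ^ 2 = 1) :
    ∃ f : Multiplicative (ZMod 2) →* K, f (Multiplicative.ofAdd 1) = t := by
  let f₀ : {f : ℤ →+ Additive K // f (2 : ℕ) = 0} := ⟨zmultiplesHom _ (Additive.ofMul t), by
    rw [zmultiplesHom_apply, natCast_zsmul, ← ofMul_pow, ht, ofMul_one]⟩
  refine ⟨AddMonoidHom.toMultiplicativeLeft (ZMod.lift 2 f₀), ?_⟩
  have h := ZMod.lift_coe 2 f₀ 1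
  rw [Int.cast_one, zmultiplesHom_apply, one_zsmul] at h
  exact congrArg Additive.toMul h

section Cone

/-- The union of the open cone spanned by the columns of `P⁻¹` (for `P` invertible) and its
negative. -/
def doubleCone (P : Matrix (Fin 5) (Fin 5) ℚ) : Set (Fin 5 → ℚ) :=
  {x | (∀ i, 0 < (P *ᵥ x) i) ∨ ∀ i, 0 < (P *ᵥ (-x)) i}

theorem neg_mem_doubleCone {P : Matrix (Fin 5) (Fin 5) ℚ} {x : Fin 5 → ℚ}
    (hx : x ∈ doubleCone P) : -x ∈ doubleCone P := by
  simpa [doubleCone, or_comm] using hx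

theorem mulVec_mem_doubleCone {P M : Matrix (Fin 5) (Fin 5) ℚ} {N : Matrix (Fin 5) (Fin 5) ℕ}
    (h : P * M = N.map (↑) * P) (hN : ∀ i, 0 < N i i) {x : Fin 5 → ℚ} (hx : x ∈ doubleCone P) :
    M *ᵥ x ∈ doubleCone P := by
  have key : ∀ y : Fin 5 → ℚ, (∀ i, 0 < (P *ᵥ y) i) → ∀ i, 0 < (P *ᵥ (M *ᵥ y)) i := by
    intro y hy i
    rw [mulVec_mulVec, h, ← mulVec_mulVec]
    exact Finset.sum_pos' (fun j _ => mul_nonneg (Nat.cast_nonneg (N i j)) (hy j).le)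
      ⟨i, Finset.mem_univ i, mul_pos (Nat.cast_pos.2 (hN i)) (hy i)⟩
  refine hx.imp (key x) fun h => ?_
  rw [← mulVec_neg]
  exact key _ h

/-- The matrix `A`, the companion matrix of `(X - 1) ^ 5`. -/
def matA : Matrix (Fin 5) (Fin 5) ℚ :=
  !![0, 0, 0, 0, 1; 1, 0, 0, 0, -5; 0, 1, 0, 0, 10; 0, 0, 1, 0, -10; 0, 0, 0, 1, 5]

/-- The matrix `B`, the companion matrix of `(X + 1) ^ 5`. -/
def matB : Matrix (Fin 5) (Fin 5) ℚ :=
  !![0, 0, 0, 0, -1; 1, 0, 0, 0, -5; 0, 1, 0, 0, -10; 0, 0, 1, 0, -10; 0, 0, 0, 1, -5]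

/-- The reflection `T = B * A⁻¹`. -/
def matT : Matrix (Fin 5) (Fin 5) ℚ :=
  !![-1, 0, 0, 0, 0; 0, 1, 0, 0, 0; -20, 0, 1, 0, 0; 0, 0, 0, 1, 0; -10, 0, 0, 0, 1]

/-- An involution commuting with `T` and inverting `B`. -/
def matS : Matrix (Fin 5) (Fin 5) ℚ :=
  !![1, 0, 0, 0, 0; 5, 0, 0, 0, -1; 10, 0, 0, -1, 0; 10, 0, -1, 0, 0; 5, -1, 0, 0, 0]

/-- The facets of a cone preserved, up to sign, by `B`, `B * T` and `B * T * S`. -/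
def matP : Matrix (Fin 5) (Fin 5) ℚ :=
  !![31, -1, -1, -1, -1; -13, 2, 1, 0, -1; 8, -3, 0, 1, 0; -3, 2, -1, 0, 1; 1, -1, 1, -1, 1]

theorem companionMatrix_X_sub_one_pow : companionMatrix ((X - 1) ^ 5) = matA := by
  have h : ((X - 1) ^ 5 : ℚ[X]) =
      X ^ 5 - C 5 * X ^ 4 + C 10 * X ^ 3 - C 10 * X ^ 2 + C 5 * X - C 1 := by
    simp only [map_ofNat, map_one]
    ring
  rw [h]
  ext i j
  fin_cases i <;> fin_cases j <;>
    simp [companionMatrix, matA, coeff_X, coeff_X_pow, coeff_one]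

theorem companionMatrix_X_add_one_pow : companionMatrix ((X + 1) ^ 5) = matB := by
  have h : ((X + 1) ^ 5 : ℚ[X]) =
      X ^ 5 + C 5 * X ^ 4 + C 10 * X ^ 3 + C 10 * X ^ 2 + C 5 * X + C 1 := by
    simp only [map_ofNat, map_one]
    ring
  rw [h]
  ext i j
  fin_cases i <;> fin_cases j <;>
    simp [companionMatrix, matB, coeff_X, coeff_X_pow, coeff_one]

theorem matT_mul_matT : matT * matT = 1 := by decide +kernel

theorem matS_mul_matS : matS * matS = 1 := by decide +kernel

theorem matT_mul_matA : matT * matA = matB := by decide +kernel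

theorem matS_mul_matT : matS * matT = matT * matS := by decide +kernel

theorem matS_mul_matB_mul_matS_mul_matB : matS * matB * matS * matB = 1 := by decide +kernel

theorem matB_mulVec_mem_doubleCone {x : Fin 5 → ℚ} (hx : x ∈ doubleCone matP) :
    matB *ᵥ x ∈ doubleCone matP := by
  have h : matP * -matB = (!![1, 4, 4, 4, 2; 0, 1, 2, 2, 1; 0, 0, 1, 2, 1; 0, 0, 0, 1, 1;
      0, 0, 0, 0, 1] : Matrix (Fin 5) (Fin 5) ℕ).map (↑) * matP := by decide +kernel
  simpa [neg_mulVec] using neg_mem_doubleCone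
    (mulVec_mem_doubleCone h (by decide) hx)

theorem matB_mul_matT_mulVec_mem_doubleCone {x : Fin 5 → ℚ} (hx : x ∈ doubleCone matP) :
    (matB * matT) *ᵥ x ∈ doubleCone matP := by
  have h : matP * (matB * matT) = (!![1, 0, 0, 0, 0; 1, 1, 0, 0, 0; 1, 2, 1, 0, 0;
      1, 2, 2, 1, 0; 2, 4, 4, 4, 1] : Matrix (Fin 5) (Fin 5) ℕ).map (↑) * matP := by decide +kernel
  exact mulVec_mem_doubleCone h (by decide) hx

theorem matB_mul_matT_mul_matS_mulVec_mem_doubleCone {x : Fin 5 → ℚ}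
    (hx : x ∈ doubleCone matP) : (matB * matT * matS) *ᵥ x ∈ doubleCone matP := by
  have h : matP * (matB * matT * matS) = (!![1, 4, 4, 4, 2; 1, 3, 2, 2, 1; 1, 2, 1, 2, 1;
      1, 2, 2, 3, 1; 2, 4, 4, 4, 1] : Matrix (Fin 5) (Fin 5) ℕ).map (↑) * matP := by decide +kernel
  exact mulVec_mem_doubleCone h (by decide) hx

/-- A quadratic form, invariant under `S` and anti-invariant under `T`, that is positive on the
cone. -/
def separatingForm (x : Fin 5 → ℚ) : ℚ :=
  x 0 * (45 * x 0 + 11 * x 1 + x 2 - x 3 - 11 * x 4)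

theorem separatingForm_pos {x : Fin 5 → ℚ} (hx : x ∈ doubleCone matP) :
    0 < separatingForm x := by
  have key : ∀ y : Fin 5 → ℚ, (∀ i, 0 < (matP *ᵥ y) i) → 0 < separatingForm y := by
    intro y hy
    have h0 := hy 0
    have h1 := hy 1
    have h2 := hy 2
    have h3 := hy 3
    have h4 := hy 4
    simp [matP, mulVec, dotProduct, Fin.sum_univ_succ] at h0 h1 h2 h3 h4
    exact mul_pos (by linarith) (by linarith)
  rcases hx with h | h
  · exact key x h
  · have := key _ h
    simp only [separatingForm, Pi.neg_apply] at this ⊢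
    linarith

theorem separatingForm_matS (x : Fin 5 → ℚ) : separatingForm (matS *ᵥ x) = separatingForm x := by
  simp only [separatingForm, matS, mulVec, dotProduct, Fin.sum_univ_five, of_apply, cons_val]
  ring

theorem separatingForm_matT (x : Fin 5 → ℚ) : separatingForm (matT *ᵥ x) = -separatingForm x := by
  simp only [separatingForm, matT, mulVec, dotProduct, Fin.sum_univ_five, of_apply, cons_val]
  ring

theorem doubleCone_matP_nonempty : (doubleCone matP).Nonempty :=
  ⟨![17, 78, 176, 114, 95], Or.inl (by decide +kernel)⟩

end Cone

/-- `Γ(f,g) = ⟨T⟩ ∗ ⟨B⟩` for `f = ((X - 1) ^ 5)`, `g = ((X + 1) ^ 5)`. -/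
theorem hypergeometric_free_product_case0 (A B T : GL (Fin 5) ℚ)
    (hA : (↑A : Matrix (Fin 5) (Fin 5) ℚ) = companionMatrix ((X - 1) ^ 5))
    (hB : (↑B : Matrix (Fin 5) (Fin 5) ℚ) = companionMatrix ((X + 1) ^ 5))
    (hT : T = B * A⁻¹) :
    T ^ 2 = 1 ∧ T ≠ 1 ∧ ¬ IsOfFinOrder B ∧
    ∃ φ : Monoid.Coprod (Multiplicative (ZMod 2)) (Multiplicative ℤ) →* GL (Fin 5) ℚ,
      φ (Monoid.Coprod.inl (Multiplicative.ofAdd (1 : ZMod 2))) = T ∧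
      φ (Monoid.Coprod.inr (Multiplicative.ofAdd (1 : ℤ))) = B ∧
      Function.Injective φ ∧
      φ.range = Subgroup.closure {A, B} := by
  have hA' : (A : Matrix (Fin 5) (Fin 5) ℚ) = matA := hA.trans companionMatrix_X_sub_one_pow
  have hB' : (B : Matrix (Fin 5) (Fin 5) ℚ) = matB := hB.trans companionMatrix_X_add_one_pow
  let S : GL (Fin 5) ℚ := ⟨matS, matS, matS_mul_matS, matS_mul_matS⟩
  have hTA : T * A = B := by rw [hT, inv_mul_cancel_right]
  have hT' : (T : Matrix (Fin 5) (Fin 5) ℚ) = matT := by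
    let T₀ : GL (Fin 5) ℚ := ⟨matT, matT, matT_mul_matT, matT_mul_matT⟩
    have h : T₀ * A = B := Units.ext (by rw [Units.val_mul, hA', hB']; exact matT_mul_matA)
    rw [← mul_right_cancel (h.trans hTA.symm)]
  have hT2 : T ^ 2 = 1 := by
    rw [sq]
    exact Units.ext (by rw [Units.val_mul, hT']; exact matT_mul_matT)
  have hSB : S * B * S = B⁻¹ := eq_inv_of_mul_eq_one_left <| Units.ext <| by
    simp only [Units.val_mul, hB']
    exact matS_mul_matB_mul_matS_mul_matB
  have hS : ∀ x : Fin 5 → ℚ, S • x = matS *ᵥ x := fun _ => rfl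
  have hTx : ∀ x : Fin 5 → ℚ, T • x = matT *ᵥ x := fun x => by rw [← hT']; rfl
  obtain ⟨f, hf⟩ := exists_monoidHom_of_sq_eq_one hT2
  let g : Multiplicative ℤ →* GL (Fin 5) ℚ := zpowersHom _ B
  have hg : g (Multiplicative.ofAdd 1) = B := by simp [g]
  have hinj : Function.Injective (Monoid.Coprod.lift f g) := by
    refine coprod_lift_injective_of_reflection (s := S) hT2 (Units.ext matS_mul_matS) ?_ hSB
      doubleCone_matP_nonempty ?_ ?_ ?_ ?_ f hf g hg
    · exact Units.ext (by simp only [Units.val_mul, hT']; exact matS_mul_matT)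
    · intro x hx
      rw [Units.smul_def, hB']
      exact matB_mulVec_mem_doubleCone hx
    · intro x hx
      rw [Units.smul_def, Units.val_mul, hB', hT']
      exact matB_mul_matT_mulVec_mem_doubleCone hx
    · intro x hx
      rw [Units.smul_def, Units.val_mul, Units.val_mul, hB', hT']
      exact matB_mul_matT_mul_matS_mulVec_mem_doubleCone hx
    · intro x hx hTx'
      have h₁ : 0 < separatingForm x := by
        rcases hx with h | h
        · exact separatingForm_pos h
        · simpa only [hS, separatingForm_matS] using separatingForm_pos h
      have h₂ : 0 < separatingForm (matT *ᵥ x) := by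
        rw [hTx] at hTx'
        rcases hTx' with h | h
        · exact separatingForm_pos h
        · simpa only [hS, separatingForm_matS] using separatingForm_pos h
      rw [separatingForm_matT] at h₂
      linarith
  have hgz : ∀ k : ℤ, g (Multiplicative.ofAdd k) = B ^ k := fun k => by simp [g]
  refine ⟨hT2, ?_, ?_, Monoid.Coprod.lift f g, ?_, ?_, hinj, ?_⟩
  · intro h
    have := congrArg (fun M : GL (Fin 5) ℚ => (M : Matrix (Fin 5) (Fin 5) ℚ) 0 0) h
    norm_num [hT', matT] at this
  · rw [isOfFinOrder_iff_zpow_eq_one]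
    rintro ⟨n, hn, h⟩
    rw [← hgz, ← Monoid.Coprod.lift_apply_inr f g] at h
    have := Monoid.Coprod.inr_injective (hinj (h.trans (map_one _).symm) |>.trans (map_one _).symm)
    exact hn this
  · rw [Monoid.Coprod.lift_apply_inl, hf]
  · rw [Monoid.Coprod.lift_apply_inr, hg]
  · rw [Monoid.Coprod.range_lift]
    have hAm : A ∈ Subgroup.closure {A, B} := Subgroup.subset_closure (by simp)
    have hBm : B ∈ Subgroup.closure {A, B} := Subgroup.subset_closure (by simp)
    have hTf : T ∈ f.range := ⟨_, hf⟩
    have hBg : B ∈ g.range := ⟨_, hg⟩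
    apply le_antisymm
    · refine sup_le ?_ ?_
      · rintro _ ⟨a, rfl⟩
        have ha : ∀ a : Multiplicative (ZMod 2), a = 1 ∨ a = Multiplicative.ofAdd 1 := by decide
        rcases ha a with rfl | rfl
        · rw [map_one]
          exact one_mem _
        · rw [hf, hT]
          exact mul_mem hBm (inv_mem hAm)
      · rintro _ ⟨k, rfl⟩
        exact hgz k ▸ zpow_mem hBm _
    · rw [Subgroup.closure_le, Set.insert_subset_iff, Set.singleton_subset_iff]
      have hA_eq : A = T⁻¹ * B := eq_inv_mul_of_mul_eq hTA
      refine ⟨?_, Subgroup.mem_sup_right hBg⟩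
      rw [hA_eq]
      exact mul_mem (inv_mem (Subgroup.mem_sup_left hTf)) (Subgroup.mem_sup_right hBg)
end

section
/- Let A be the companion matrix of f(x) = (x-1)^5 and B the companion matrix of g(x) = (x+1)³(x²+1), and set T = B·A⁻¹ in GL(5,ℚ). Then T² = I with T ≠ I, B has infinite order, and the hypergeometric group Γ(f,g) = ⟨A,B⟩ is the free product of the subgroup generated by T and the subgroup generated by B: the canonical group homomorphism from the abstract free product (ℤ/2ℤ) ∗ ℤ to GL(5,ℚ) sending the generator of ℤ/2ℤ to T and the generator of ℤ to B is injective with image Γ(f,g). -/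
open Polynomial Matrix

namespace Monoid

/-- **Ping-pong lemma** for the free product of two groups, one of which has at least three
elements. -/
theorem Coprod.lift_injective_of_ping_pong.{u} {M N : Type u} {G α : Type*} [Group M] [Group N]
    [Group G] [MulAction G α] (f : M →* G) (g : N →* G) (hN : 3 ≤ Cardinal.mk N) (X Y : Set α)
    (hX : X.Nonempty) (hY : Y.Nonempty) (hXY : Disjoint X Y)
    (hf : ∀ m ≠ 1, ∀ y ∈ Y, f m • y ∈ X) (hg : ∀ n ≠ 1, ∀ x ∈ X, g n • x ∈ Y) :
    Function.Injective (Coprod.lift f g) := by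
  let H : Bool → Type u := fun b => cond b N M
  let _ : ∀ b, Group (H b) := Bool.rec ‹Group M› ‹Group N›
  let F : ∀ b, H b →* G := Bool.rec f g
  have hF : Function.Injective (CoprodI.lift F) := by
    refine CoprodI.lift_injective_of_ping_pong F (.inr ⟨true, hN⟩) (fun b => cond b Y X) ?_ ?_ ?_
    · rintro (_ | _) <;> assumption
    · rintro (_ | _) (_ | _) h
      · exact absurd rfl h
      · exact hXY
      · exact hXY.symm
      · exact absurd rfl h
    · rintro (_ | _) (_ | _) h
      · exact absurd rfl h
      · rintro m hm _ ⟨y, hy, rfl⟩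
        exact hf m hm y hy
      · rintro n hn _ ⟨x, hx, rfl⟩
        exact hg n hn x hx
      · exact absurd rfl h
  let Ψ : Coprod M N →* CoprodI H :=
    Coprod.lift (CoprodI.of (M := H) (i := false)) (CoprodI.of (M := H) (i := true))
  let I : ∀ b, H b →* Coprod M N := Bool.rec Coprod.inl Coprod.inr
  let Θ : CoprodI H →* Coprod M N := CoprodI.lift I
  have hΨ : Function.LeftInverse Θ Ψ := by
    refine DFunLike.congr_fun (f := Θ.comp Ψ) (g := MonoidHom.id _) (Coprod.hom_ext ?_ ?_)
    · ext m; exact CoprodI.lift_of (M := H) I (i := false) m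
    · ext n; exact CoprodI.lift_of (M := H) I (i := true) n
  have hlift : Coprod.lift f g = (CoprodI.lift F).comp Ψ := by
    refine Coprod.hom_ext ?_ ?_
    · ext m; exact (CoprodI.lift_of (M := H) F (i := false) m).symm
    · ext n; exact (CoprodI.lift_of (M := H) F (i := true) n).symm
  rw [hlift]
  exact hF.comp hΨ.injective

end Monoid

/-- The quasi-polynomial `k ↦ a₂ k² + a₁ k + a₀ + c cos (π k / 2) + s sin (π k / 2)`. -/
@[ext]
structure QuasiPoly where
  a₂ : ℚ
  a₁ : ℚ
  a₀ : ℚ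
  c : ℚ
  s : ℚ

/-- The rational number `cos (π k / 2)`. -/
def quarterCos (k : ℤ) : ℚ := if k % 4 = 0 then 1 else if k % 4 = 2 then -1 else 0

/-- The rational number `sin (π k / 2)`. -/
def quarterSin (k : ℤ) : ℚ := if k % 4 = 1 then 1 else if k % 4 = 3 then -1 else 0

lemma quarterCos_sq_add_quarterSin_sq (k : ℤ) : quarterCos k ^ 2 + quarterSin k ^ 2 = 1 := by
  have : k % 4 = 0 ∨ k % 4 = 1 ∨ k % 4 = 2 ∨ k % 4 = 3 := by omega
  rcases this with h | h | h | h <;> norm_num [quarterCos, quarterSin, h]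

lemma quarterCos_neg (k : ℤ) : quarterCos (-k) = quarterCos k := by
  unfold quarterCos
  split_ifs <;> first | rfl | omega

lemma quarterSin_neg (k : ℤ) : quarterSin (-k) = -quarterSin k := by
  unfold quarterSin
  split_ifs <;> first | omega | norm_num

lemma quarterCos_add_one (k : ℤ) : quarterCos (k + 1) = -quarterSin k := by
  unfold quarterCos quarterSin
  split_ifs <;> first | omega | norm_num

lemma quarterSin_add_one (k : ℤ) : quarterSin (k + 1) = quarterCos k := by
  unfold quarterCos quarterSin
  split_ifs <;> first | omega | norm_num

namespace QuasiPoly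

instance : Neg QuasiPoly := ⟨fun q => ⟨-q.a₂, -q.a₁, -q.a₀, -q.c, -q.s⟩⟩

@[simp] lemma neg_a₂ (q : QuasiPoly) : (-q).a₂ = -q.a₂ := rfl
@[simp] lemma neg_a₁ (q : QuasiPoly) : (-q).a₁ = -q.a₁ := rfl
@[simp] lemma neg_a₀ (q : QuasiPoly) : (-q).a₀ = -q.a₀ := rfl
@[simp] lemma neg_c (q : QuasiPoly) : (-q).c = -q.c := rfl
@[simp] lemma neg_s (q : QuasiPoly) : (-q).s = -q.s := rfl

/-- The value of a quasi-polynomial at an integer. -/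
def eval (q : QuasiPoly) (k : ℤ) : ℚ :=
  q.a₂ * k ^ 2 + q.a₁ * k + q.a₀ + q.c * quarterCos k + q.s * quarterSin k

/-- The quasi-polynomial `j ↦ q (j + k)`. -/
def shift (k : ℤ) (q : QuasiPoly) : QuasiPoly where
  a₂ := q.a₂
  a₁ := q.a₁ + 2 * k * q.a₂
  a₀ := q.a₂ * k ^ 2 + q.a₁ * k + q.a₀
  c := q.c * quarterCos k + q.s * quarterSin k
  s := q.s * quarterCos k - q.c * quarterSin k

/-- The quasi-polynomial `j ↦ q (-j)`. -/
def mirror (q : QuasiPoly) : QuasiPoly := ⟨q.a₂, -q.a₁, q.a₀, q.c, -q.s⟩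

/-- The quasi-polynomial `j ↦ q 0 * (8 j² + 2 cos (π j / 2)) - q j`. -/
def flip (q : QuasiPoly) : QuasiPoly :=
  ⟨8 * (q.a₀ + q.c) - q.a₂, -q.a₁, -q.a₀, 2 * (q.a₀ + q.c) - q.c, -q.s⟩

/-- Half of the inequalities cutting out the ping-pong cone. -/
structure HalfCone (q : QuasiPoly) : Prop where
  h₁ : 0 < q.a₂ + q.a₁ - q.c + q.s
  h₂ : 0 < q.a₂ + 2 * q.a₁ + 3 * q.a₀ + q.c + 3 * q.s
  h₃ : 0 < q.a₂ + 3 * q.a₁ + 4 * q.a₀ + 2 * q.c + 6 * q.s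
  h₄ : 0 < q.a₁ + 2 * q.a₀ + 2 * q.c + 2 * q.s
  h₅ : 0 < q.a₂ + q.a₁ + 3 * q.c - 3 * q.s
  h₆ : 0 < 11 * q.a₂ + 13 * q.a₁ + 14 * q.a₀ - 3 * q.c + 11 * q.s
  h₇ : 0 < 10 * q.a₂ + 21 * q.a₁ + 27 * q.a₀ + 7 * q.c + 37 * q.s

/-- The ping-pong cone: it is preserved by `q ↦ (shift k q).flip` for all `k ≠ 0`. -/
def Cone (q : QuasiPoly) : Prop := q.HalfCone ∧ q.mirror.HalfCone

lemma shift_neg_eq (k : ℤ) (q : QuasiPoly) : shift k (-q) = -shift k q := by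
  ext <;> simp [shift] <;> ring

lemma flip_neg_eq (q : QuasiPoly) : flip (-q) = -flip q := by
  ext <;> simp [flip] <;> ring

lemma shift_zero (q : QuasiPoly) : shift 0 q = q := by
  ext <;> simp [shift, quarterCos, quarterSin]

lemma shift_one_shift (k : ℤ) (q : QuasiPoly) : shift 1 (shift k q) = shift (k + 1) q := by
  ext <;> simp [shift, quarterCos_add_one, quarterSin_add_one] <;>
    norm_num [quarterCos, quarterSin] <;> ring

lemma shift_neg_shift (k : ℤ) (q : QuasiPoly) : shift (-k) (shift k q) = q := by
  have h := quarterCos_sq_add_quarterSin_sq k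
  ext <;> simp [shift, quarterCos_neg, quarterSin_neg]
  · ring
  · linear_combination q.c * h
  · linear_combination q.s * h

lemma mirror_mirror (q : QuasiPoly) : q.mirror.mirror = q := by
  ext <;> simp [mirror]

lemma mirror_shift (k : ℤ) (q : QuasiPoly) : (shift k q).mirror = shift (-k) q.mirror := by
  ext <;> simp [mirror, shift, quarterCos_neg, quarterSin_neg] <;> ring

lemma mirror_flip (q : QuasiPoly) : q.flip.mirror = q.mirror.flip := by
  ext <;> simp [mirror, flip]

lemma eval_mirror (k : ℤ) (q : QuasiPoly) : q.mirror.eval k = q.eval (-k) := by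
  simp [mirror, eval, quarterCos_neg, quarterSin_neg]

lemma eval_shift_neg (k : ℤ) (q : QuasiPoly) : (shift k q).eval (-k) = q.eval 0 := by
  have h := quarterCos_sq_add_quarterSin_sq k
  have h0 : quarterCos 0 = 1 := by norm_num [quarterCos]
  have h1 : quarterSin 0 = 0 := by norm_num [quarterSin]
  simp only [eval, shift, quarterCos_neg, quarterSin_neg, h0, h1]
  push_cast
  linear_combination q.c * h

lemma eval_shift_zero (k : ℤ) (q : QuasiPoly) : (shift k q).eval 0 = q.eval k := by
  have h0 : quarterCos 0 = 1 := by norm_num [quarterCos]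
  have h1 : quarterSin 0 = 0 := by norm_num [quarterSin]
  simp only [eval, shift, h0, h1]
  push_cast
  ring

lemma Cone.mirror {q : QuasiPoly} (h : q.Cone) : q.mirror.Cone :=
  ⟨h.2, by rw [mirror_mirror]; exact h.1⟩

lemma exists_pos_residue {k : ℤ} (hk : 0 < k) : ∃ m : ℚ, 0 ≤ m ∧
    ((k = 1 + 4 * m ∧ quarterCos k = 0 ∧ quarterSin k = 1) ∨
     (k = 2 + 4 * m ∧ quarterCos k = -1 ∧ quarterSin k = 0) ∨
     (k = 3 + 4 * m ∧ quarterCos k = 0 ∧ quarterSin k = -1) ∨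
     (k = 4 + 4 * m ∧ quarterCos k = 1 ∧ quarterSin k = 0)) := by
  refine ⟨((k - 1) / 4 : ℤ), by exact_mod_cast (by omega), ?_⟩
  have : k % 4 = 1 ∨ k % 4 = 2 ∨ k % 4 = 3 ∨ k % 4 = 0 := by omega
  rcases this with h | h | h | h
  · exact .inl ⟨by exact_mod_cast (by omega : k = 1 + 4 * ((k - 1) / 4)),
      by simp [quarterCos, h], by simp [quarterSin, h]⟩
  · exact .inr <| .inl ⟨by exact_mod_cast (by omega : k = 2 + 4 * ((k - 1) / 4)),
      by simp [quarterCos, h], by simp [quarterSin, h]⟩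
  · exact .inr <| .inr <| .inl ⟨by exact_mod_cast (by omega : k = 3 + 4 * ((k - 1) / 4)),
      by simp [quarterCos, h], by simp [quarterSin, h]⟩
  · exact .inr <| .inr <| .inr ⟨by exact_mod_cast (by omega : k = 4 + 4 * ((k - 1) / 4)),
      by simp [quarterCos, h], by simp [quarterSin, h]⟩

theorem Cone.flip_shift_of_pos {q : QuasiPoly} (h : q.Cone) {k : ℤ} (hk : 0 < k) :
    (shift k q).flip.Cone := by
  obtain ⟨⟨h₁, h₂, h₃, h₄, h₅, h₆, h₇⟩, ⟨g₁, g₂, g₃, g₄, g₅, g₆, g₇⟩⟩ := h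
  obtain ⟨m, hm, hmk⟩ := exists_pos_residue hk
  obtain ⟨a₂, a₁, a₀, c, s⟩ := q
  simp only [QuasiPoly.mirror] at *
  have key {L : ℚ} (h : 0 < L) : 0 ≤ m * L ∧ 0 ≤ m ^ 2 * L := ⟨by positivity, by positivity⟩
  have := key h₁
  have := key h₂
  have := key h₃
  have := key h₄
  have := key h₅
  have := key h₆
  have := key h₇
  have := key g₁
  have := key g₂
  have := key g₃
  have := key g₄
  have := key g₅
  have := key g₆
  have := key g₇
  rcases hmk with ⟨e, ec, es⟩ | ⟨e, ec, es⟩ | ⟨e, ec, es⟩ | ⟨e, ec, es⟩ <;>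
    constructor <;> constructor <;>
    simp only [shift, flip, QuasiPoly.mirror, e, ec, es] <;> linarith

theorem Cone.flip_shift {q : QuasiPoly} (h : q.Cone) {k : ℤ} (hk : k ≠ 0) :
    (shift k q).flip.Cone := by
  rcases hk.lt_or_gt with hk | hk
  · have := (h.mirror.flip_shift_of_pos (Int.neg_pos.mpr hk)).mirror
    rwa [mirror_flip, mirror_shift, mirror_mirror, neg_neg] at this
  · exact h.flip_shift_of_pos hk

lemma Cone.eval_zero_pos {q : QuasiPoly} (h : q.Cone) : 0 < q.eval 0 := by
  obtain ⟨⟨h₁, h₂, h₃, h₄, h₅, h₆, h₇⟩, ⟨g₁, g₂, g₃, g₄, g₅, g₆, g₇⟩⟩ := h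
  simp only [QuasiPoly.mirror] at *
  norm_num [eval, quarterCos, quarterSin]
  linarith

lemma Cone.eval_zero_lt_of_pos {q : QuasiPoly} (h : q.Cone) {k : ℤ} (hk : 0 < k) :
    q.eval 0 < q.eval k := by
  obtain ⟨⟨h₁, h₂, h₃, h₄, h₅, h₆, h₇⟩, ⟨g₁, g₂, g₃, g₄, g₅, g₆, g₇⟩⟩ := h
  obtain ⟨m, hm, hmk⟩ := exists_pos_residue hk
  obtain ⟨a₂, a₁, a₀, c, s⟩ := q
  simp only [QuasiPoly.mirror] at *
  have h0 : quarterCos 0 = 1 := by norm_num [quarterCos]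
  have h0' : quarterSin 0 = 0 := by norm_num [quarterSin]
  have key {L : ℚ} (h : 0 < L) : 0 ≤ m * L ∧ 0 ≤ m ^ 2 * L := ⟨by positivity, by positivity⟩
  have := key h₁
  have := key h₂
  have := key h₃
  have := key h₄
  have := key h₅
  have := key g₁
  have := key g₂
  have := key g₃
  have := key g₄
  have := key g₅
  rcases hmk with ⟨e, ec, es⟩ | ⟨e, ec, es⟩ | ⟨e, ec, es⟩ | ⟨e, ec, es⟩ <;>
    simp only [eval, e, ec, es, h0, h0'] <;> push_cast <;> linarith

lemma Cone.eval_zero_lt {q : QuasiPoly} (h : q.Cone) {k : ℤ} (hk : k ≠ 0) :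
    q.eval 0 < q.eval k := by
  rcases hk.lt_or_gt with hk | hk
  · simpa [eval_mirror] using h.mirror.eval_zero_lt_of_pos (Int.neg_pos.mpr hk)
  · exact h.eval_zero_lt_of_pos hk

lemma eval_neg_eq (k : ℤ) (q : QuasiPoly) : (-q).eval k = -q.eval k := by
  simp [eval]; ring

lemma Cone.ne_shift {p q : QuasiPoly} (hp : p.Cone) (hq : q.Cone) {k : ℤ} (hk : k ≠ 0) :
    p ≠ shift k q := by
  rintro rfl
  have h := hp.eval_zero_lt (neg_ne_zero.mpr hk)
  rw [eval_shift_neg, eval_shift_zero] at h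
  exact h.not_gt (hq.eval_zero_lt hk)

lemma Cone.ne_neg_shift {p q : QuasiPoly} (hp : p.Cone) (hq : q.Cone) (k : ℤ) :
    p ≠ -shift k q := by
  rintro rfl
  have h := hp.eval_zero_pos
  rw [eval_neg_eq, eval_shift_zero] at h
  rcases eq_or_ne k 0 with rfl | hk
  · linarith [hq.eval_zero_pos]
  · linarith [hq.eval_zero_pos, hq.eval_zero_lt hk]

lemma neg_neg_eq (q : QuasiPoly) : - -q = q := by
  ext <;> simp

end QuasiPoly

lemma companionMatrix_X_sub_one_pow_five : companionMatrix ((X - 1) ^ 5) =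
    !![0, 0, 0, 0, 1; 1, 0, 0, 0, -5; 0, 1, 0, 0, 10; 0, 0, 1, 0, -10; 0, 0, 0, 1, 5] := by
  have h : ((X - 1) ^ 5 : ℚ[X]) =
      X ^ 5 - C 5 * X ^ 4 + C 10 * X ^ 3 - C 10 * X ^ 2 + C 5 * X - C 1 := by
    simp only [map_ofNat, map_one]; ring
  rw [h]
  ext i j
  fin_cases i <;> fin_cases j <;> simp [companionMatrix, coeff_X, coeff_X_pow, coeff_one]

lemma companionMatrix_X_add_one_pow_three_mul : companionMatrix ((X + 1) ^ 3 * (X ^ 2 + 1)) =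
    !![0, 0, 0, 0, -1; 1, 0, 0, 0, -3; 0, 1, 0, 0, -4; 0, 0, 1, 0, -4; 0, 0, 0, 1, -3] := by
  have h : ((X + 1) ^ 3 * (X ^ 2 + 1) : ℚ[X]) =
      X ^ 5 + C 3 * X ^ 4 + C 4 * X ^ 3 + C 4 * X ^ 2 + C 3 * X + C 1 := by
    simp only [map_ofNat, map_one]; ring
  rw [h]
  ext i j
  fin_cases i <;> fin_cases j <;> simp [companionMatrix, coeff_X, coeff_X_pow, coeff_one]

/-- The reflection `B * A⁻¹`. -/
def reflection : Matrix (Fin 5) (Fin 5) ℚ :=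
  !![-1, 0, 0, 0, 0; 2, 1, 0, 0, 0; -14, 0, 1, 0, 0; 6, 0, 0, 1, 0; -8, 0, 0, 0, 1]

lemma reflection_mul_self : reflection * reflection = 1 := by
  ext i j
  fin_cases i <;> fin_cases j <;>
    simp [reflection, Matrix.mul_apply, Fin.sum_univ_succ]

lemma coe_eq_reflection {A B T : GL (Fin 5) ℚ}
    (hA : (A : Matrix (Fin 5) (Fin 5) ℚ) = companionMatrix ((X - 1) ^ 5))
    (hB : (B : Matrix (Fin 5) (Fin 5) ℚ) = companionMatrix ((X + 1) ^ 3 * (X ^ 2 + 1)))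
    (hTA : T * A = B) : (T : Matrix (Fin 5) (Fin 5) ℚ) = reflection := by
  refine A.isUnit.mul_right_cancel ?_
  rw [← Units.val_mul, hTA, hA, hB, companionMatrix_X_sub_one_pow_five,
    companionMatrix_X_add_one_pow_three_mul]
  ext i j
  fin_cases i <;> fin_cases j <;>
    simp [reflection, Matrix.mul_apply, Fin.sum_univ_succ] <;> norm_num

namespace QuasiPoly

/-- Coordinates on `ℚ⁵` in which the companion matrix of `(X + 1) ^ 3 * (X ^ 2 + 1)` acts as
`q ↦ -shift 1 q`. -/
def ofVec (x : Fin 5 → ℚ) : QuasiPoly where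
  a₂ := -x 0 + x 1 - x 2 + x 3 - x 4
  a₁ := 5 * x 0 - 3 * x 1 + x 2 + x 3 - 3 * x 4
  a₀ := -5 * x 0 + x 1 + x 2 - x 3 - x 4
  c := x 0 - x 1 - x 2 + x 3 + x 4
  s := x 0 + x 1 - x 2 - x 3 + x 4

lemma ofVec_companionMatrix_mulVec (x : Fin 5 → ℚ) :
    ofVec (companionMatrix ((X + 1) ^ 3 * (X ^ 2 + 1)) *ᵥ x) = -shift 1 (ofVec x) := by
  rw [companionMatrix_X_add_one_pow_three_mul]
  ext <;> simp [ofVec, shift, quarterCos, quarterSin, Matrix.mulVec, dotProduct,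
    Fin.sum_univ_succ] <;> ring

lemma ofVec_reflection_mulVec (x : Fin 5 → ℚ) : ofVec (reflection *ᵥ x) = -flip (ofVec x) := by
  ext <;> simp [reflection, ofVec, flip, Matrix.mulVec, dotProduct, Fin.sum_univ_succ] <;> ring

lemma shift_neg_one_shift (k : ℤ) (q : QuasiPoly) : shift (-1) (shift k q) = shift (k - 1) q := by
  have h := shift_one_shift (k - 1) q
  rw [sub_add_cancel] at h
  rw [← h, shift_neg_shift]

end QuasiPoly

open QuasiPoly

/-- `GL (Fin 5) ℚ` acts on column vectors. -/
instance : MulAction (GL (Fin 5) ℚ) (Fin 5 → ℚ) where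
  smul g x := (g : Matrix (Fin 5) (Fin 5) ℚ) *ᵥ x
  one_smul := Matrix.one_mulVec
  mul_smul _ _ x := (Matrix.mulVec_mulVec x _ _).symm

lemma GL_smul_def (g : GL (Fin 5) ℚ) (x : Fin 5 → ℚ) :
    g • x = (g : Matrix (Fin 5) (Fin 5) ℚ) *ᵥ x := rfl

lemma ofVec_zpow_smul {B : GL (Fin 5) ℚ}
    (hB : (B : Matrix (Fin 5) (Fin 5) ℚ) = companionMatrix ((X + 1) ^ 3 * (X ^ 2 + 1)))
    (k : ℤ) (x : Fin 5 → ℚ) :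
    ofVec (B ^ k • x) = shift k (ofVec x) ∨ ofVec (B ^ k • x) = -shift k (ofVec x) := by
  have hs (y : Fin 5 → ℚ) : ofVec (B • y) = -shift 1 (ofVec y) := by
    rw [GL_smul_def, hB, ofVec_companionMatrix_mulVec]
  have hs' (y : Fin 5 → ℚ) : ofVec (B⁻¹ • y) = -shift (-1) (ofVec y) := by
    have h := hs (B⁻¹ • y)
    rw [smul_inv_smul] at h
    rw [h, shift_neg_eq, shift_neg_shift, neg_neg_eq]
  induction k using Int.induction_on with
  | zero => simp [shift_zero]
  | succ k ih =>
    rw [add_comm, _root_.zpow_add, zpow_one, mul_smul, hs, add_comm, ← shift_one_shift]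
    rcases ih with ih | ih
    · exact .inr (by rw [ih])
    · exact .inl (by rw [ih, shift_neg_eq, neg_neg_eq])
  | pred k ih =>
    rw [sub_eq_add_neg, add_comm, _root_.zpow_add, _root_.zpow_neg_one, mul_smul, hs', add_comm,
      ← sub_eq_add_neg, ← shift_neg_one_shift]
    rcases ih with ih | ih
    · exact .inr (by rw [ih])
    · exact .inl (by rw [ih, shift_neg_eq, neg_neg_eq])

theorem lift_injective_of_eq_reflection {B T : GL (Fin 5) ℚ}
    (hB : (B : Matrix (Fin 5) (Fin 5) ℚ) = companionMatrix ((X + 1) ^ 3 * (X ^ 2 + 1)))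
    (hT : (T : Matrix (Fin 5) (Fin 5) ℚ) = reflection)
    (f : Multiplicative (ZMod 2) →* GL (Fin 5) ℚ) (hf : f (Multiplicative.ofAdd 1) = T) :
    Function.Injective (Monoid.Coprod.lift f (zpowersHom _ B)) := by
  let X : Set (Fin 5 → ℚ) := {x | (ofVec x).Cone ∨ (-ofVec x).Cone}
  let Y : Set (Fin 5 → ℚ) :=
    {x | ∃ k ≠ 0, ∃ q : QuasiPoly, q.Cone ∧ (ofVec x = shift k q ∨ ofVec x = -shift k q)}
  have hX : ![-1, 4, -12, 8, -7] ∈ X := by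
    have h : ofVec ![-1, 4, -12, 8, -7] = ⟨32, 0, -4, 8, 0⟩ := by
      ext <;> simp [ofVec] <;> norm_num
    left
    rw [h]
    constructor <;> constructor <;> norm_num [QuasiPoly.mirror]
  have hXY : ∀ n ≠ 1, ∀ x ∈ X, zpowersHom _ B n • x ∈ Y := by
    intro n hn x hx
    have hk : n.toAdd ≠ 0 := hn
    have h := ofVec_zpow_smul hB n.toAdd x
    rw [zpowersHom_apply]
    rcases hx with hx | hx
    · exact ⟨_, hk, _, hx, h⟩
    · refine ⟨_, hk, _, hx, ?_⟩
      rw [shift_neg_eq, neg_neg_eq]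
      exact h.symm
  have hYX : ∀ m ≠ 1, ∀ y ∈ Y, f m • y ∈ X := by
    rintro m hm y ⟨k, hk, q, hq, h⟩
    have hm : m = Multiplicative.ofAdd 1 := by
      revert m; decide
    have hy : ofVec (f m • y) = -flip (ofVec y) := by
      rw [hm, hf, GL_smul_def, hT, ofVec_reflection_mulVec]
    change (ofVec (f m • y)).Cone ∨ (-ofVec (f m • y)).Cone
    rw [hy, neg_neg_eq]
    rcases h with h | h <;> rw [h]
    · exact .inr (hq.flip_shift hk)
    · rw [flip_neg_eq, neg_neg_eq]
      exact .inl (hq.flip_shift hk)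
  refine Monoid.Coprod.lift_injective_of_ping_pong f (zpowersHom _ B)
    (Cardinal.ofNat_le_aleph0.trans (Cardinal.aleph0_le_mk _)) X Y ⟨_, hX⟩
    ⟨_, hXY (Multiplicative.ofAdd 1) (by decide) _ hX⟩ ?_ hYX hXY
  rw [Set.disjoint_left]
  rintro x hx ⟨k, hk, q, hq, h⟩
  rcases hx with hx | hx <;> rcases h with h | h <;> rw [h] at hx
  · exact hx.ne_shift hq hk rfl
  · exact hx.ne_neg_shift hq k rfl
  · exact hx.ne_neg_shift hq k rfl
  · rw [neg_neg_eq] at hx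
    exact hx.ne_shift hq hk rfl

/-- `Γ(f,g) = ⟨T⟩ ∗ ⟨B⟩` for `f = ((X - 1) ^ 5)`, `g = ((X + 1) ^ 3 * (X ^ 2 + 1))`. -/
theorem hypergeometric_free_product_case2 (A B T : GL (Fin 5) ℚ)
    (hA : (↑A : Matrix (Fin 5) (Fin 5) ℚ) = companionMatrix ((X - 1) ^ 5))
    (hB : (↑B : Matrix (Fin 5) (Fin 5) ℚ) = companionMatrix ((X + 1) ^ 3 * (X ^ 2 + 1)))
    (hT : T = B * A⁻¹) :
    T ^ 2 = 1 ∧ T ≠ 1 ∧ ¬ IsOfFinOrder B ∧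
    ∃ φ : Monoid.Coprod (Multiplicative (ZMod 2)) (Multiplicative ℤ) →* GL (Fin 5) ℚ,
      φ (Monoid.Coprod.inl (Multiplicative.ofAdd (1 : ZMod 2))) = T ∧
      φ (Monoid.Coprod.inr (Multiplicative.ofAdd (1 : ℤ))) = B ∧
      Function.Injective φ ∧
      φ.range = Subgroup.closure {A, B} := by
  have hTA : T * A = B := by rw [hT, inv_mul_cancel_right]
  have hTr := coe_eq_reflection hA hB hTA
  have hT2 : T ^ 2 = 1 := by
    ext1
    simp [sq, hTr, reflection_mul_self]
  let f : Multiplicative (ZMod 2) →* GL (Fin 5) ℚ :=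
    MonoidHom.mk' (fun z => T ^ z.toAdd.val) fun y z => by
      rw [toAdd_mul, ZMod.val_add, ← pow_eq_pow_mod _ hT2, pow_add]
  have hf : f (Multiplicative.ofAdd 1) = T := pow_one T
  let φ := Monoid.Coprod.lift f (zpowersHom _ B)
  have hφ : Function.Injective φ := lift_injective_of_eq_reflection hB hTr f hf
  have hφT : φ (Monoid.Coprod.inl (Multiplicative.ofAdd (1 : ZMod 2))) = T := hf
  have hφB : φ (Monoid.Coprod.inr (Multiplicative.ofAdd (1 : ℤ))) = B := zpow_one B
  refine ⟨hT2, ?_, ?_, φ, hφT, hφB, hφ, ?_⟩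
  · rw [← hφT, Ne, map_eq_one_iff φ hφ, map_eq_one_iff _ Monoid.Coprod.inl_injective]
    decide
  · intro h
    obtain ⟨n, hn, hBn⟩ := isOfFinOrder_iff_pow_eq_one.mp h
    rw [← hφB, ← map_pow, ← map_pow, map_eq_one_iff φ hφ,
      map_eq_one_iff _ Monoid.Coprod.inr_injective, ← ofAdd_nsmul, ofAdd_eq_one] at hBn
    simp at hBn
    omega
  · refine le_antisymm ?_ ?_
    · have hAc : A ∈ Subgroup.closure {A, B} := Subgroup.subset_closure (by simp)
      have hBc : B ∈ Subgroup.closure {A, B} := Subgroup.subset_closure (by simp)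
      rw [Monoid.Coprod.range_lift, sup_le_iff]
      constructor
      · rintro _ ⟨z, rfl⟩
        exact pow_mem (hT ▸ mul_mem hBc (inv_mem hAc)) _
      · rintro _ ⟨z, rfl⟩
        exact zpow_mem hBc _
    · have hBr : B ∈ φ.range := ⟨_, hφB⟩
      have hTr : T ∈ φ.range := ⟨_, hφT⟩
      rw [Subgroup.closure_le, Set.pair_subset_iff]
      exact ⟨eq_inv_mul_of_mul_eq hTA ▸ mul_mem (inv_mem hTr) hBr, hBr⟩
end
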